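/- arXiv:2003.06259 — 2 statements merged into one kernel-verified Lean document; each statement's English description precedes it below -/
import Mathlib

section
/- In the finite matrix MDP setup with initial distributions, suppose ‖R‖_∞ ≤ Rmax, ‖Pπ - Pμ‖_op ≤ ε, and ‖π₀ - μ₀‖₁ ≤ ε. Then for every k ≥ 1 the k-th order term of the Taylor expansion of the RL objective satisfies |Lₖ| ≤ (γ/(1-γ))^(k-1) · ε^k · Rmax/(1-γ)². -/
open Matrix

/-- Sup norm of a vector. -/
noncomputable def vecSupNorm {S : Type*} [Fintype S] (v : S → ℝ) : ℝ := ⨆ s, |v s|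

/-- Maximum row ℓ1-norm of a matrix. -/
noncomputable def matOpNorm {S : Type*} [Fintype S] (A : Matrix S S ℝ) : ℝ :=
  ⨆ s, ∑ t, |A s t|

lemma aux_dot {S : Type*} [Fintype S] (a v : S → ℝ) (C A : ℝ) (hC : 0 ≤ C)
    (ha : ∑ s, |a s| ≤ A) (hv : ∀ s, |v s| ≤ C) : |a ⬝ᵥ v| ≤ A * C := by
  unfold dotProduct
  calc |∑ i, a i * v i| ≤ ∑ i, |a i * v i| := Finset.abs_sum_le_sum_abs _ _
    _ ≤ ∑ i, |a i| * C := by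
        apply Finset.sum_le_sum
        intro i _
        rw [abs_mul]
        exact mul_le_mul_of_nonneg_left (hv i) (abs_nonneg _)
    _ = (∑ i, |a i|) * C := by rw [Finset.sum_mul]
    _ ≤ A * C := mul_le_mul_of_nonneg_right ha hC

lemma aux_core {S : Type*} [Fintype S] [Nonempty S] [DecidableEq S]
    (γ : ℝ) (hγ0 : 0 ≤ γ) (hγ1 : γ < 1) (P : Matrix S S ℝ)
    (h0 : ∀ s t, 0 ≤ P s t) (h1 : ∀ s, ∑ t, P s t = 1) (w : S → ℝ) (C : ℝ)
    (hw : ∀ s, |((1 - γ • P) *ᵥ w) s| ≤ C) : ∀ s, |w s| ≤ C / (1 - γ) := by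
  obtain ⟨m, hm⟩ := Finite.exists_max (fun s => |w s|)
  have e : ((1 - γ • P) *ᵥ w) m = w m - γ * (P m ⬝ᵥ w) := by
    rw [Matrix.sub_mulVec, Matrix.one_mulVec, Matrix.smul_mulVec]
    rfl
  have hb : |P m ⬝ᵥ w| ≤ 1 * |w m| := by
    apply aux_dot _ _ _ _ (abs_nonneg _) _ hm
    simp only [abs_of_nonneg (h0 m _)]
    exact (h1 m).le
  have h2 := hw m
  rw [e] at h2
  have h3 : |w m| ≤ |w m - γ * (P m ⬝ᵥ w)| + |γ * (P m ⬝ᵥ w)| := by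
    simpa using abs_add_le (w m - γ * (P m ⬝ᵥ w)) (γ * (P m ⬝ᵥ w))
  rw [abs_mul, abs_of_nonneg hγ0] at h3
  have h4 := mul_le_mul_of_nonneg_left hb hγ0
  intro s
  refine (hm s).trans ?_
  rw [le_div_iff₀ (by linarith)]
  nlinarith

lemma aux_inv {S : Type*} [Fintype S] [Nonempty S] [DecidableEq S]
    (γ : ℝ) (hγ0 : 0 ≤ γ) (hγ1 : γ < 1) (P : Matrix S S ℝ)
    (h0 : ∀ s t, 0 ≤ P s t) (h1 : ∀ s, ∑ t, P s t = 1) (v : S → ℝ) (C : ℝ)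
    (hv : ∀ s, |v s| ≤ C) : ∀ s, |((1 - γ • P)⁻¹ *ᵥ v) s| ≤ C / (1 - γ) := by
  have hd : (1 - γ • P).det ≠ 0 := by
    intro h
    obtain ⟨w, hw, hw0⟩ := Matrix.exists_mulVec_eq_zero_iff.mpr h
    apply hw
    ext s
    have := aux_core γ hγ0 hγ1 P h0 h1 w 0 (by simp [hw0]) s
    simpa using this
  apply aux_core γ hγ0 hγ1 P h0 h1
  rw [Matrix.mulVec_mulVec, Matrix.mul_nonsing_inv _ (isUnit_iff_ne_zero.mpr hd), Matrix.one_mulVec]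
  exact hv

/-- **Bound on the k-th order term of the Taylor expansion of the RL objective.**
`|Lₖ| ≤ (γ/(1-γ))^(k-1) · ε^k · Rmax/(1-γ)²` for all `k ≥ 1`. -/
theorem stmt_9 {S : Type*} [Fintype S] [Nonempty S] [DecidableEq S]
    (γ : ℝ) (hγ0 : 0 ≤ γ) (hγ1 : γ < 1)
    (Pπ Pμ : Matrix S S ℝ)
    (hPπ0 : ∀ s t, 0 ≤ Pπ s t) (hPπ1 : ∀ s, ∑ t, Pπ s t = 1)
    (hPμ0 : ∀ s t, 0 ≤ Pμ s t) (hPμ1 : ∀ s, ∑ t, Pμ s t = 1)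
    (R : S → ℝ) (Qμ : S → ℝ) (hQμ : Qμ = (1 - γ • Pμ)⁻¹ *ᵥ R)
    (M : Matrix S S ℝ) (hM : M = γ • ((1 - γ • Pμ)⁻¹ * (Pπ - Pμ)))
    (π₀ μ₀ : S → ℝ)
    (hπ₀0 : ∀ s, 0 ≤ π₀ s) (hπ₀1 : ∑ s, π₀ s = 1)
    (hμ₀0 : ∀ s, 0 ≤ μ₀ s) (hμ₀1 : ∑ s, μ₀ s = 1)
    (L : ℕ → ℝ)
    (hL1 : L 1 = (π₀ - μ₀) ⬝ᵥ Qμ + μ₀ ⬝ᵥ ((M ^ 1) *ᵥ Qμ))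
    (hLk : ∀ k : ℕ, 2 ≤ k →
      L k = (π₀ - μ₀) ⬝ᵥ ((M ^ (k - 1)) *ᵥ Qμ) + μ₀ ⬝ᵥ ((M ^ k) *ᵥ Qμ))
    (Rmax ε : ℝ) (hR : vecSupNorm R ≤ Rmax) (hε : matOpNorm (Pπ - Pμ) ≤ ε)
    (hinit : ∑ s, |π₀ s - μ₀ s| ≤ ε) :
    ∀ k : ℕ, 1 ≤ k →
      |L k| ≤ (γ / (1 - γ)) ^ (k - 1) * ε ^ k * (Rmax / (1 - γ) ^ 2) := by
  have hR' : ∀ s, |R s| ≤ Rmax := fun s =>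
    (le_ciSup (f := fun s => |R s|) (Set.finite_range _).bddAbove s).trans hR
  have hε' : ∀ s, ∑ t, |(Pπ - Pμ) s t| ≤ ε := fun s =>
    (le_ciSup (f := fun s => ∑ t, |(Pπ - Pμ) s t|) (Set.finite_range _).bddAbove s).trans hε
  have hε0 : 0 ≤ ε := (Finset.sum_nonneg fun _ _ => abs_nonneg _).trans hinit
  have hRm : 0 ≤ Rmax := (abs_nonneg _).trans (hR' (Classical.arbitrary S))
  have hg : 0 < 1 - γ := by linarith
  have hU : ∀ k : ℕ, ∀ s, |((M ^ k) *ᵥ Qμ) s| ≤ (γ * ε / (1 - γ)) ^ k * (Rmax / (1 - γ)) := by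
    intro k
    induction k with
    | zero =>
      intro s
      simpa [hQμ] using aux_inv γ hγ0 hγ1 Pμ hPμ0 hPμ1 R Rmax hR' s
    | succ k ih =>
      intro s
      have hC : 0 ≤ (γ * ε / (1 - γ)) ^ k * (Rmax / (1 - γ)) := by positivity
      have h := aux_inv γ hγ0 hγ1 Pμ hPμ0 hPμ1 ((Pπ - Pμ) *ᵥ ((M ^ k) *ᵥ Qμ)) _
        (fun t => aux_dot _ _ _ _ hC (hε' t) ih) s
      have e : ((M ^ (k + 1)) *ᵥ Qμ) s
          = γ * ((1 - γ • Pμ)⁻¹ *ᵥ ((Pπ - Pμ) *ᵥ ((M ^ k) *ᵥ Qμ))) s := by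
        have e2 : M ^ (k + 1) = γ • ((1 - γ • Pμ)⁻¹ * ((Pπ - Pμ) * M ^ k)) := by
          rw [pow_succ', ← Matrix.mul_assoc, ← Matrix.smul_mul, ← hM]
        rw [e2, Matrix.smul_mulVec, Matrix.mulVec_mulVec, Matrix.mulVec_mulVec, Matrix.mul_assoc]
        rfl
      rw [e, abs_mul, abs_of_nonneg hγ0]
      refine (mul_le_mul_of_nonneg_left h hγ0).trans (le_of_eq ?_)
      rw [pow_succ]
      ring
  have hL : ∀ k : ℕ, L (k + 1) =
      (π₀ - μ₀) ⬝ᵥ ((M ^ k) *ᵥ Qμ) + μ₀ ⬝ᵥ ((M ^ (k + 1)) *ᵥ Qμ) := by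
    intro k
    rcases k with _ | k
    · simpa using hL1
    · exact hLk (k + 2) (by omega)
  intro k hk
  obtain ⟨k, rfl⟩ : ∃ j, k = j + 1 := ⟨k - 1, by omega⟩
  rw [hL, Nat.add_sub_cancel]
  have a1 := aux_dot (π₀ - μ₀) _ _ ε (by positivity) hinit (hU k)
  have a2 := aux_dot μ₀ _ _ 1 (by positivity)
    (by simp only [abs_of_nonneg (hμ₀0 _)]; exact hμ₀1.le) (hU (k + 1))
  refine (abs_add_le _ _).trans ((add_le_add a1 a2).trans (le_of_eq ?_))
  have e1 : γ * ε / (1 - γ) = γ / (1 - γ) * ε := by ring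
  rw [e1, pow_succ, mul_pow, pow_succ]
  generalize (γ / (1 - γ)) ^ k = x
  field_simp
  ring
end

section
/- (Product-form Taylor expansion, Eq. 2) In the explicit MDP setup with μ y b > 0 for all y, b, discount γ (0 ≤ γ < 1), and reward R : S → ℝ, let D be the diagonal matrix with D (y,b) (y,b) = π y b / μ y b, and suppose γ·‖Pπ - Pμ‖_op < 1 - γ. Then the series ∑_{k=1}^{∞} (γ•((1 - γ•Pμ)⁻¹ * Pμ * (D - 1)))^k *ᵥ Qμ converges and equals Qπ - Qμ, where Qπ = (1 - γ•Pπ)⁻¹ *ᵥ R and Qμ = (1 - γ•Pμ)⁻¹ *ᵥ R. -/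
open Matrix

section Aux
attribute [local instance] Matrix.linftyOpNormedRing Matrix.linftyOpNormedAlgebra

theorem aux_norm_le {S : Type*} [Fintype S] [DecidableEq S] (B : Matrix S S ℝ) (c : ℝ)
    (hc : 0 ≤ c) (h : ∀ s, ∑ t, |B s t| ≤ c) : ‖B‖ ≤ c := by
  rw [Matrix.linfty_opNorm_def]
  lift c to NNReal using hc
  refine NNReal.coe_le_coe.2 (Finset.sup_le fun s _ => ?_)
  rw [← NNReal.coe_le_coe]
  push_cast
  simpa using h s

theorem aux_norm_le_matOpNorm {S : Type*} [Fintype S] [DecidableEq S] (B : Matrix S S ℝ) :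
    ‖B‖ ≤ matOpNorm B := by
  refine aux_norm_le B _ (Real.iSup_nonneg fun s => Finset.sum_nonneg fun t _ => abs_nonneg _) ?_
  intro s
  exact le_ciSup (f := fun s => ∑ t, |B s t|) (Set.finite_range _).bddAbove s

theorem aux_unit {S : Type*} [Fintype S] [DecidableEq S] (P : Matrix S S ℝ) (γ : ℝ)
    (hγ0 : 0 ≤ γ) (hγ1 : γ < 1) (hP : ‖P‖ ≤ 1) :
    (1 - γ • P)⁻¹ * (1 - γ • P) = 1 ∧ (1 - γ • P) * (1 - γ • P)⁻¹ = 1 := by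
  have h : ‖γ • P‖ < 1 := by
    rw [norm_smul, Real.norm_of_nonneg hγ0]
    nlinarith [norm_nonneg P]
  have hu : IsUnit (1 - γ • P) := isUnit_one_sub_of_norm_lt_one h
  have hd := (Matrix.isUnit_iff_isUnit_det _).1 hu
  exact ⟨Matrix.nonsing_inv_mul _ hd, Matrix.mul_nonsing_inv _ hd⟩

theorem aux_main {S : Type*} [Fintype S] [DecidableEq S] [Nonempty S] (P Q : Matrix S S ℝ) (γ : ℝ)
    (hγ0 : 0 ≤ γ) (hγ1 : γ < 1) (hP : ‖P‖ ≤ 1) (hQ : ‖Q‖ ≤ 1) (hs : γ * ‖Q - P‖ < 1 - γ)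
    (R : S → ℝ) (s : S) :
    HasSum (fun k : ℕ => (((γ • ((1 - γ • P)⁻¹ * (Q - P))) ^ (k + 1)) *ᵥ ((1 - γ • P)⁻¹ *ᵥ R)) s)
      (((1 - γ • Q)⁻¹ *ᵥ R - (1 - γ • P)⁻¹ *ᵥ R : S → ℝ) s) := by
  obtain ⟨h1, h2⟩ := aux_unit P γ hγ0 hγ1 hP
  obtain ⟨h3, h4⟩ := aux_unit Q γ hγ0 hγ1 hQ
  set V := (1 - γ • P)⁻¹ with hV
  set T := (1 - γ • Q)⁻¹ with hT
  set M := γ • (V * (Q - P)) with hM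
  have hVn : ‖V‖ * (1 - γ) ≤ 1 := by
    have e : V = 1 + γ • (P * V) := by
      rw [sub_mul, one_mul, smul_mul_assoc] at h2
      rw [← h2]; abel
    have a : ‖V‖ ≤ 1 + γ * ‖V‖ := by
      calc ‖V‖ = ‖1 + γ • (P * V)‖ := by rw [← e]
        _ ≤ ‖(1 : Matrix S S ℝ)‖ + ‖γ • (P * V)‖ := norm_add_le _ _
        _ ≤ 1 + γ * ‖V‖ := by
          rw [norm_one, norm_smul, Real.norm_of_nonneg hγ0]
          gcongr
          calc _ ≤ ‖P‖ * ‖V‖ := norm_mul_le _ _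
            _ ≤ 1 * ‖V‖ := by gcongr
            _ = _ := one_mul _
    linarith
  have hMn : ‖M‖ < 1 := by
    rw [hM, norm_smul, Real.norm_of_nonneg hγ0]
    have a : ‖V * (Q - P)‖ ≤ ‖V‖ * ‖Q - P‖ := norm_mul_le _ _
    have b : γ * ‖V * (Q - P)‖ ≤ ‖V‖ * (γ * ‖Q - P‖) := by nlinarith
    rcases (norm_nonneg V).eq_or_lt with h0 | h0
    · rw [← h0] at b; linarith
    · nlinarith
  have hsum : Summable (fun k : ℕ => M ^ k) := summable_geometric_of_norm_lt_one hMn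
  have hW : (∑' k : ℕ, M ^ k) * (1 - M) = 1 := geom_series_mul_neg M hMn
  set W := ∑' k : ℕ, M ^ k with hWd
  have hfac : 1 - M = V * (1 - γ • Q) := by
    have : V * (1 - γ • Q) = V * (1 - γ • P) - γ • (V * (Q - P)) := by
      rw [mul_sub, mul_sub, mul_sub, mul_smul_comm, mul_smul_comm, smul_sub]; abel
    rw [this, h1]
  have hVT : V = (1 - M) * T := by rw [hfac, mul_assoc, h4, mul_one]
  have hWV : M * W * V = T - V := by
    have e : M * T = T - V := by
      conv_rhs => rw [hVT]
      rw [sub_mul, one_mul]; abel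
    rw [mul_assoc, ← e]
    conv_lhs => rw [hVT]
    rw [← mul_assoc W, hW, one_mul]
  have hS : HasSum (fun k : ℕ => M ^ (k + 1) * V) (T - V) := by
    rw [← hWV]
    simp only [pow_succ']
    exact (hsum.hasSum.mul_left M).mul_right V
  let f : Matrix S S ℝ →+ ℝ :=
    { toFun := fun B => (B *ᵥ R) s
      map_zero' := by simp
      map_add' := by intro a b; simp [Matrix.add_mulVec] }
  have hf : Continuous f := by
    have : Continuous fun B : S → S → ℝ => ∑ t, B s t * R t := by fun_prop
    exact this
  have := hS.map f hf
  simpa [f, Function.comp_def, Matrix.sub_mulVec, Matrix.mulVec_mulVec] using this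

end Aux

/-- **Product-form Taylor expansion (Eq. 2).**
With `D` the diagonal matrix of importance ratios `π/μ`, if
`γ·‖Pπ - Pμ‖_op < 1 - γ`, then
`∑_{k=1}^∞ (γ•((1 - γ•Pμ)⁻¹ * Pμ * (D - 1)))^k *ᵥ Qμ` converges entrywise to
`Qπ - Qμ`. -/
theorem stmt_19 {X A : Type*} [Fintype X] [Fintype A] [Nonempty X] [Nonempty A]
    [DecidableEq X] [DecidableEq A]
    (p : X → A → X → ℝ) (hp0 : ∀ x a y, 0 ≤ p x a y) (hp1 : ∀ x a, ∑ y, p x a y = 1)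
    (π μ : X → A → ℝ)
    (hπ0 : ∀ x a, 0 ≤ π x a) (hπ1 : ∀ x, ∑ a, π x a = 1)
    (hμ0 : ∀ x a, 0 ≤ μ x a) (hμ1 : ∀ x, ∑ a, μ x a = 1)
    (hμpos : ∀ y b, 0 < μ y b)
    (Pπ Pμ : Matrix (X × A) (X × A) ℝ)
    (hPπ : ∀ s t, Pπ s t = p s.1 s.2 t.1 * π t.1 t.2)
    (hPμ : ∀ s t, Pμ s t = p s.1 s.2 t.1 * μ t.1 t.2)
    (γ : ℝ) (hγ0 : 0 ≤ γ) (hγ1 : γ < 1)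
    (R : X × A → ℝ) (Qπ Qμ : X × A → ℝ)
    (hQπ : Qπ = (1 - γ • Pπ)⁻¹ *ᵥ R) (hQμ : Qμ = (1 - γ • Pμ)⁻¹ *ᵥ R)
    (D : Matrix (X × A) (X × A) ℝ)
    (hD : D = Matrix.diagonal fun s : X × A => π s.1 s.2 / μ s.1 s.2)
    (hsmall : γ * matOpNorm (Pπ - Pμ) < 1 - γ) :
    ∀ s : X × A,
      HasSum
        (fun k : ℕ =>
          (((γ • ((1 - γ • Pμ)⁻¹ * Pμ * (D - 1))) ^ (k + 1)) *ᵥ Qμ) s)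
        ((Qπ - Qμ) s) := by
  have hrow : ∀ (ν : X → A → ℝ) (P : Matrix (X × A) (X × A) ℝ), (∀ x a, 0 ≤ ν x a) →
      (∀ x, ∑ a, ν x a = 1) → (∀ s t, P s t = p s.1 s.2 t.1 * ν t.1 t.2) →
      ∀ s, ∑ t, |P s t| ≤ 1 := by
    intro ν P h0 h1 hP s
    refine le_of_eq ?_
    have : ∀ t, |P s t| = p s.1 s.2 t.1 * ν t.1 t.2 := fun t => by
      rw [hP, abs_of_nonneg (mul_nonneg (hp0 _ _ _) (h0 _ _))]
    simp only [this, Fintype.sum_prod_type, ← Finset.mul_sum, h1, mul_one, hp1]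
  have hPD : Pμ * (D - 1) = Pπ - Pμ := by
    rw [mul_sub, mul_one, hD]
    congr 1
    ext s t
    rw [Matrix.mul_diagonal, hPμ, hPπ]
    have := (hμpos t.1 t.2).ne'
    field_simp
  intro s
  rw [mul_assoc, hPD, hQπ, hQμ]
  exact aux_main Pμ Pπ γ hγ0 hγ1 (aux_norm_le _ _ zero_le_one (hrow μ Pμ hμ0 hμ1 hPμ))
    (aux_norm_le _ _ zero_le_one (hrow π Pπ hπ0 hπ1 hPπ))
    (lt_of_le_of_lt (mul_le_mul_of_nonneg_left (aux_norm_le_matOpNorm _) hγ0) hsmall) R s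
end
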